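/- Let α be irrational, n ≥ 0, and ℓ a positive integer with ℓ q_n ≤ q_{n+1}. Then the set E_{n,ℓ} = ⋃_{k=0}^{ℓ q_n − 1} R_α^{−k}(I_n), where I_n = (−λ^{(n)}/2, λ^{(n)}/2) ⊂ T, is a disjoint union of the sets R_α^{−k}(I_n), and its normalized Haar measure equals λ(E_{n,ℓ}) = ℓ q_n λ^{(n)}. -/

import Mathlib

/-- The complete quotients of the continued fraction expansion of `α`
(`cfQuot α 0 = α`, and `cfQuot α (n+1)` is the inverse of the fractional part
of `cfQuot α n`). -/
noncomputable def cfQuot (α : ℝ) : ℕ → ℝ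
  | 0 => α
  | n + 1 => (cfQuot α n - ⌊cfQuot α n⌋)⁻¹

/-- The partial quotients `aₙ` of the continued fraction expansion
`α = [a₀; a₁, a₂, …]` (as natural numbers; for irrational `α` and `n ≥ 1`
one has `cfa α n ≥ 1`). -/
noncomputable def cfa (α : ℝ) (n : ℕ) : ℕ := (⌊cfQuot α n⌋).toNat

/-- The denominators `qₙ` of the convergents `pₙ/qₙ` of `α`:
`q₀ = 1`, `q₁ = a₁` and `q_{n+2} = a_{n+2} q_{n+1} + q_n`. -/
noncomputable def cfq (α : ℝ) : ℕ → ℕ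
  | 0 => 1
  | 1 => cfa α 1
  | n + 2 => cfa α (n + 2) * cfq α (n + 1) + cfq α n

/-- The numerators `pₙ` of the convergents `pₙ/qₙ` of `α`:
`p₀ = a₀`, `p₁ = a₁ a₀ + 1` and `p_{n+2} = a_{n+2} p_{n+1} + pₙ`. -/
noncomputable def cfp (α : ℝ) : ℕ → ℤ
  | 0 => ⌊α⌋
  | 1 => (cfa α 1 : ℤ) * ⌊α⌋ + 1
  | n + 2 => (cfa α (n + 2) : ℤ) * cfp α (n + 1) + cfp α n

/-- `ρₙ = qₙ α − pₙ`. -/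
noncomputable def cfrho (α : ℝ) (n : ℕ) : ℝ := (cfq α n : ℝ) * α - (cfp α n : ℝ)

/-- `λ⁽ⁿ⁾ = |ρₙ| = ‖qₙ α‖`, the distance from `qₙ α` to the nearest integer. -/
noncomputable def cflam (α : ℝ) (n : ℕ) : ℝ := |cfrho α n|

lemma irrational_cfQuot {α : ℝ} (hα : Irrational α) (n : ℕ) : Irrational (cfQuot α n) := by
  induction n with
  | zero => exact hα
  | succ n ih => exact irrational_inv_iff.mpr (ih.sub_intCast _)

lemma fract_cfQuot_pos {α : ℝ} (hα : Irrational α) (n : ℕ) :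
    0 < cfQuot α n - ⌊cfQuot α n⌋ :=
  lt_of_le_of_ne (sub_nonneg.mpr (Int.floor_le _))
    ((irrational_cfQuot hα n).sub_intCast _).ne_zero.symm

lemma cfQuot_succ_pos {α : ℝ} (hα : Irrational α) (n : ℕ) : 0 < cfQuot α (n + 1) :=
  inv_pos.mpr (fract_cfQuot_pos hα n)

lemma one_lt_cfQuot_succ {α : ℝ} (hα : Irrational α) (n : ℕ) : 1 < cfQuot α (n + 1) := by
  refine (one_lt_inv₀ (fract_cfQuot_pos hα n)).mpr ?_
  linarith [Int.lt_floor_add_one (cfQuot α n)]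

lemma cast_cfa_succ {α : ℝ} (hα : Irrational α) (n : ℕ) :
    (cfa α (n + 1) : ℝ) = ⌊cfQuot α (n + 1)⌋ := by
  have h : ((⌊cfQuot α (n + 1)⌋.toNat : ℕ) : ℤ) = ⌊cfQuot α (n + 1)⌋ :=
    Int.toNat_of_nonneg (Int.floor_nonneg.mpr (cfQuot_succ_pos hα n).le)
  exact_mod_cast congrArg (Int.cast : ℤ → ℝ) h

lemma cfa_sub_cfQuot_mul {α : ℝ} (hα : Irrational α) (n : ℕ) :
    ((cfa α (n + 1) : ℝ) - cfQuot α (n + 1)) * cfQuot α (n + 2) = -1 := by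
  have h := mul_inv_cancel₀ (fract_cfQuot_pos hα (n + 1)).ne'
  rw [cast_cfa_succ hα, show cfQuot α (n + 2) = (cfQuot α (n + 1) - ⌊cfQuot α (n + 1)⌋)⁻¹ from rfl]
  linarith

lemma cfrho_zero (α : ℝ) : cfrho α 0 = α - ⌊α⌋ := by
  simp [cfrho, cfq, cfp]

lemma cfrho_add_two (α : ℝ) (n : ℕ) :
    cfrho α (n + 2) = cfa α (n + 2) * cfrho α (n + 1) + cfrho α n := by
  simp only [cfrho, cfq, cfp]
  push_cast
  ring

lemma cfrho_succ_mul_cfQuot {α : ℝ} (hα : Irrational α) (n : ℕ) :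
    cfrho α (n + 1) * cfQuot α (n + 2) = -cfrho α n := by
  induction n with
  | zero =>
    have h0 : cfrho α 0 * cfQuot α 1 = 1 := by
      rw [cfrho_zero]
      exact mul_inv_cancel₀ (fract_cfQuot_pos hα 0).ne'
    have h1 : cfrho α 1 = cfa α 1 * cfrho α 0 - 1 := by
      simp only [cfrho, cfq, cfp]
      push_cast
      ring
    have h := cfa_sub_cfQuot_mul hα 0
    simp only [zero_add] at h ⊢
    rw [h1]
    linear_combination cfrho α 0 * h + cfQuot α 2 * h0
  | succ n ih =>
    have h := cfa_sub_cfQuot_mul hα (n + 1)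
    rw [cfrho_add_two]
    linear_combination cfrho α (n + 1) * h + cfQuot α (n + 3) * ih

lemma cfrho_zero_pos {α : ℝ} (hα : Irrational α) : 0 < cfrho α 0 := by
  rw [cfrho_zero]
  exact fract_cfQuot_pos hα 0

lemma cfrho_mul_succ_nonpos {α : ℝ} (hα : Irrational α) (n : ℕ) :
    cfrho α n * cfrho α (n + 1) ≤ 0 := by
  have h := cfrho_succ_mul_cfQuot hα n
  have ht := cfQuot_succ_pos hα (n + 1)
  have : cfrho α n = -(cfrho α (n + 1) * cfQuot α (n + 2)) := by linarith
  rw [this]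
  nlinarith [mul_nonneg (mul_self_nonneg (cfrho α (n + 1))) ht.le]

lemma cflam_succ_le {α : ℝ} (hα : Irrational α) (n : ℕ) : cflam α (n + 1) ≤ cflam α n := by
  have h := congrArg abs (cfrho_succ_mul_cfQuot hα n)
  rw [abs_mul, abs_neg, abs_of_pos (cfQuot_succ_pos hα (n + 1))] at h
  rw [cflam, cflam, ← h]
  exact le_mul_of_one_le_right (abs_nonneg _) (one_lt_cfQuot_succ hα (n + 1)).le

lemma cflam_le_one {α : ℝ} (hα : Irrational α) (n : ℕ) : cflam α n ≤ 1 := by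
  refine (antitone_nat_of_succ_le (cflam_succ_le hα) (Nat.zero_le n)).trans ?_
  rw [cflam, abs_of_pos (cfrho_zero_pos hα), cfrho_zero]
  linarith [Int.lt_floor_add_one α]

lemma cfq_mul_cfp_sub (α : ℝ) (n : ℕ) :
    (cfq α n : ℤ) * cfp α (n + 1) - cfq α (n + 1) * cfp α n = (-1) ^ n := by
  induction n with
  | zero => simp [cfq, cfp]
  | succ n ih =>
    rw [pow_succ, ← ih]
    simp only [cfq, cfp]
    push_cast
    ring

/-- The best approximation property of the convergents. -/
lemma cflam_le_abs_mul_sub {α : ℝ} (hα : Irrational α) {n : ℕ} {k : ℤ} (hk : 0 < k)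
    (hkq : k < cfq α (n + 1)) (m : ℤ) : cflam α n ≤ |(k : ℝ) * α - m| := by
  obtain ⟨d, hd, hdd⟩ : ∃ d : ℤ,
      (cfq α n : ℤ) * cfp α (n + 1) - cfq α (n + 1) * cfp α n = d ∧ d * d = 1 :=
    ⟨_, cfq_mul_cfp_sub α n, by rw [← mul_pow]; simp⟩
  set x := d * (k * cfp α (n + 1) - m * cfq α (n + 1))
  set y := d * (cfq α n * m - cfp α n * k)
  have hxk : k = x * cfq α n + y * cfq α (n + 1) := by
    linear_combination (-k) * hdd - d * k * hd
  have hxm : m = x * cfp α n + y * cfp α (n + 1) := by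
    linear_combination (-m) * hdd - d * m * hd
  have hq : (0 : ℤ) ≤ cfq α n := Int.natCast_nonneg _
  have hx : x ≠ 0 := by
    intro hx
    rw [hx, zero_mul, zero_add] at hxk
    have : 0 < y := by by_contra! hy; nlinarith
    nlinarith
  have hxy : x * y ≤ 0 := by
    by_contra! h
    rcases pos_and_pos_or_neg_and_neg_of_mul_pos h with ⟨h1, h2⟩ | ⟨h1, h2⟩ <;> nlinarith
  have hρ : (k : ℝ) * α - m = x * cfrho α n + y * cfrho α (n + 1) := by
    rw [hxk, hxm, cfrho, cfrho]
    push_cast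
    ring
  have hx1 : (1 : ℝ) ≤ (x : ℝ) * x := by
    have : 1 ≤ x * x := by have := mul_self_pos.mpr hx; omega
    exact_mod_cast this
  have hxy' : (x : ℝ) * y ≤ 0 := by exact_mod_cast hxy
  rw [hρ, cflam]
  apply sq_le_sq.mp
  nlinarith [mul_nonneg_of_nonpos_of_nonpos hxy' (cfrho_mul_succ_nonpos hα n),
    mul_le_mul_of_nonneg_right hx1 (mul_self_nonneg (cfrho α n)),
    mul_self_nonneg ((y : ℝ) * cfrho α (n + 1))]

lemma cflam_le_norm_sub {α : ℝ} (hα : Irrational α) {n k₁ k₂ : ℕ} (h₁ : k₁ < k₂)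
    (h₂ : k₂ < cfq α (n + 1)) :
    cflam α n ≤ ‖k₂ • (α : UnitAddCircle) - k₁ • (α : UnitAddCircle)‖ := by
  have h : k₂ • (α : UnitAddCircle) - k₁ • (α : UnitAddCircle) =
      ((((k₂ : ℤ) - k₁ : ℤ) * α : ℝ) : UnitAddCircle) := by
    push_cast
    rw [sub_mul, AddCircle.coe_sub, ← nsmul_eq_mul, ← nsmul_eq_mul, AddCircle.coe_nsmul,
      AddCircle.coe_nsmul]
  rw [h, UnitAddCircle.norm_eq]
  exact cflam_le_abs_mul_sub hα (by omega) (by omega) _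

lemma disjoint_preimage_add_nsmul {α : ℝ} (hα : Irrational α) {n k₁ k₂ : ℕ}
    (h₁ : k₁ < cfq α (n + 1)) (h₂ : k₂ < cfq α (n + 1)) (hne : k₁ ≠ k₂) :
    Disjoint
      ((fun z : UnitAddCircle => z + k₁ • (α : UnitAddCircle)) ⁻¹'
        {z : UnitAddCircle | ‖z‖ < cflam α n / 2})
      ((fun z : UnitAddCircle => z + k₂ • (α : UnitAddCircle)) ⁻¹'
        {z : UnitAddCircle | ‖z‖ < cflam α n / 2}) := by
  wlog h : k₁ < k₂ generalizing k₁ k₂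
  · exact (this h₂ h₁ hne.symm (by omega)).symm
  refine Set.disjoint_left.mpr fun z hz₁ hz₂ => ?_
  have hz := norm_sub_le (z + k₂ • (α : UnitAddCircle)) (z + k₁ • (α : UnitAddCircle))
  rw [add_sub_add_left_eq_sub] at hz
  simp only [Set.mem_preimage, Set.mem_ofPred_eq] at hz₁ hz₂
  linarith [cflam_le_norm_sub hα h h₂]

lemma UnitAddCircle.volume_norm_lt_half {r : ℝ} (hr : r ≤ 1) :
    MeasureTheory.volume {z : UnitAddCircle | ‖z‖ < r / 2} = ENNReal.ofReal r := by
  have h : {z : UnitAddCircle | ‖z‖ < r / 2} = Metric.ball 0 (r / 2) := by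
    ext z
    simp
  rw [h, ← MeasureTheory.measure_congr AddCircle.closedBall_ae_eq_ball, AddCircle.volume_closedBall,
    mul_div_cancel₀ _ two_ne_zero, min_eq_right hr]

/-- Let `α` be irrational and `ℓ ≥ 1` with `ℓ qₙ ≤ q_{n+1}`.
Then the sets `R_α^{−k}(Iₙ)`, `0 ≤ k < ℓqₙ`, with `Iₙ` the open arc of radius
`λ⁽ⁿ⁾/2` around `0`, are pairwise disjoint, and the Haar measure of their
union `E_{n,ℓ}` equals `ℓ qₙ λ⁽ⁿ⁾`. -/
theorem stmt_9 (α : ℝ) (hα : Irrational α) (n ℓ : ℕ) (hℓ : 0 < ℓ)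
    (hle : ℓ * cfq α n ≤ cfq α (n + 1)) :
    (∀ k₁ ∈ Finset.range (ℓ * cfq α n), ∀ k₂ ∈ Finset.range (ℓ * cfq α n), k₁ ≠ k₂ →
      Disjoint
        ((fun z : UnitAddCircle => z + k₁ • (α : UnitAddCircle)) ⁻¹'
          {z : UnitAddCircle | ‖z‖ < cflam α n / 2})
        ((fun z : UnitAddCircle => z + k₂ • (α : UnitAddCircle)) ⁻¹'
          {z : UnitAddCircle | ‖z‖ < cflam α n / 2})) ∧
    MeasureTheory.volume
        (⋃ k ∈ Finset.range (ℓ * cfq α n),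
          (fun z : UnitAddCircle => z + k • (α : UnitAddCircle)) ⁻¹'
            {z : UnitAddCircle | ‖z‖ < cflam α n / 2}) =
      ENNReal.ofReal ((ℓ : ℝ) * (cfq α n : ℝ) * cflam α n) := by
  have hlt : ∀ k ∈ Finset.range (ℓ * cfq α n), k < cfq α (n + 1) := fun k hk =>
    (Finset.mem_range.mp hk).trans_le hle
  have hdisj := fun k₁ hk₁ k₂ hk₂ hne =>
    disjoint_preimage_add_nsmul hα (hlt k₁ hk₁) (hlt k₂ hk₂) hne
  refine ⟨hdisj, ?_⟩
  have hmeas : MeasurableSet {z : UnitAddCircle | ‖z‖ < cflam α n / 2} :=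
    measurableSet_lt measurable_norm measurable_const
  rw [MeasureTheory.measure_biUnion_finset hdisj fun k _ => hmeas.preimage (measurable_add_const _)]
  simp only [MeasureTheory.measure_preimage_add_right,
    UnitAddCircle.volume_norm_lt_half (cflam_le_one hα n), Finset.sum_const, Finset.card_range]
  rw [← ENNReal.ofReal_nsmul, nsmul_eq_mul, Nat.cast_mul]
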